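/- In the Case A setup (see context), every good configuration U′ satisfies ω_p(U′, f) = ω⁺_f for all edges f ∈ 𝓔 \ 𝓔_e, and ω_p(U′, f) = 𝟙_{U′_f ≤ p} for all f ∈ 𝓔_e. -/

import Mathlib

open MeasureTheory

namespace CDP

/-- Vertices of the hypercubic lattice `ℤ^d`. -/
abbrev Vertex (d : ℕ) := Fin d → ℤ

/-- Nearest-neighbour adjacency in `ℤ^d`. -/
def adj {d : ℕ} (x y : Vertex d) : Prop := (∑ i, |x i - y i|) = 1

/-- `e` is a nearest-neighbour (non-oriented) edge of `ℤ^d`, i.e. an element of `𝓔`. -/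
def IsNNEdge {d : ℕ} (e : Sym2 (Vertex d)) : Prop := ∃ x y, adj x y ∧ e = s(x, y)

/-- Configurations: labels attached to (unordered) pairs of vertices; only the labels of
nearest-neighbour edges (elements of `𝓔`) are ever relevant. -/
abbrev Config (d : ℕ) := Sym2 (Vertex d) → ℝ

/-- `ℓ^1` norm of a vertex. -/
def norm1 {d : ℕ} (x : Vertex d) : ℤ := ∑ i, |x i|

/-- The set `Ω`: configurations with values in `[0,1]`, pairwise distinct coordinates on `𝓔`,
and no infinite walk along which the labels are strictly monotone. -/
def goodConfigs (d : ℕ) : Set (Config d) :=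
  {U | (∀ e, IsNNEdge e → U e ∈ Set.Icc (0 : ℝ) 1) ∧
    (∀ e f, IsNNEdge e → IsNNEdge f → U e = U f → e = f) ∧
    ¬ ∃ w : ℕ → Vertex d, (∀ i, adj (w i) (w (i + 1))) ∧
      (StrictMono (fun i => U s(w i, w (i + 1))) ∨ StrictAnti (fun i => U s(w i, w (i + 1))))}

/-- A labelling `σ` of the edges by "ever opens" which is consistent with the
constrained-degree dynamics driven by `U`: an edge (attempting to open at time `U e`)
opens iff at that moment both of its end-vertices have degree `< κ` among the
previously opened edges. -/
def Consistent {d : ℕ} (κ : ℕ) (U : Config d) (σ : Sym2 (Vertex d) → Prop) : Prop :=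
  ∀ e, IsNNEdge e →
    (σ e ↔ ∀ v ∈ e,
      Set.ncard {f : Sym2 (Vertex d) | IsNNEdge f ∧ v ∈ f ∧ f ≠ e ∧ U f < U e ∧ σ f} < κ)

/-- `ω_p(U, e) = 1`, i.e. the edge `e` is `p`-open in the constrained-degree percolation
process with constraint `κ` driven by `U`. -/
def openEdge {d : ℕ} (κ : ℕ) (U : Config d) (p : ℝ) (e : Sym2 (Vertex d)) : Prop :=
  IsNNEdge e ∧ U e ≤ p ∧ ∃ σ, Consistent κ U σ ∧ σ e

/-- `x 0, …, x k` is a path: consecutive vertices adjacent, all vertices distinct. -/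
def IsPathOn {d : ℕ} (k : ℕ) (x : ℕ → Vertex d) : Prop :=
  (∀ i < k, adj (x i) (x (i + 1))) ∧ ∀ i ≤ k, ∀ j ≤ k, x i = x j → i = j

/-- The modified one-arm event `E_n(p)`: a path `x_0, …, x_k` with `‖x_0‖₁ = n`,
`‖x_i‖₁ < n` for `1 ≤ i ≤ k`, `x_k = 0`, whose head consists of `p`-open edges and whose
tail is decreasing (values `≤ p`, strictly decreasing towards the origin). -/
def modifiedOneArm {d : ℕ} (κ n : ℕ) (p : ℝ) (U : Config d) : Prop :=
  ∃ (k : ℕ) (x : ℕ → Vertex d),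
    IsPathOn k x ∧ norm1 (x 0) = (n : ℤ) ∧ (∀ i, 1 ≤ i → i ≤ k → norm1 (x i) < (n : ℤ)) ∧
    x k = 0 ∧
    ∃ l ≤ k,
      (∀ i < l, openEdge κ U p s(x i, x (i + 1))) ∧
      (∀ i, l ≤ i → i < k → U s(x i, x (i + 1)) ≤ p) ∧
      (∀ i, l ≤ i → i + 1 < k → U s(x (i + 1), x (i + 2)) < U s(x i, x (i + 1)))

/-- `a` and `b` are connected by a `p`-open path. -/
def openConn {d : ℕ} (κ : ℕ) (U : Config d) (p : ℝ) (a b : Vertex d) : Prop :=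
  ∃ (k : ℕ) (x : ℕ → Vertex d), IsPathOn k x ∧ x 0 = a ∧ x k = b ∧
    ∀ i < k, openEdge κ U p s(x i, x (i + 1))

/-- There is an infinite `p`-open path starting at the origin. -/
def zeroToInf {d : ℕ} (κ : ℕ) (U : Config d) (p : ℝ) : Prop :=
  ∃ x : ℕ → Vertex d, x 0 = 0 ∧ (∀ i, adj (x i) (x (i + 1))) ∧ Function.Injective x ∧
    ∀ i, openEdge κ U p s(x i, x (i + 1))

/-- `P` is the law of i.i.d. `Uniform[0,1]` labels: a probability measure whose
finite-dimensional cylinder probabilities are products of uniform probabilities. -/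
def IsProductUniform {d : ℕ} (P : Measure (Config d)) : Prop :=
  IsProbabilityMeasure P ∧
    ∀ (s : Finset (Sym2 (Vertex d))) (f : Sym2 (Vertex d) → Set ℝ),
      (∀ e ∈ s, MeasurableSet (f e)) →
      P {U | ∀ e ∈ s, U e ∈ f e} = ∏ e ∈ s, volume (f e ∩ Set.Icc 0 1)

/-- The one-arm probability `θ_n(p)`. -/
noncomputable def theta {d : ℕ} (κ : ℕ) (P : Measure (Config d)) (n : ℕ) (p : ℝ) : ℝ :=
  (P {U | U ∈ goodConfigs d ∧ ∃ b, norm1 b = (n : ℤ) ∧ openConn κ U p 0 b}).toReal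

/-- `θ(p) = ℙ(0 ↔ ∞)`. -/
noncomputable def thetaInf {d : ℕ} (κ : ℕ) (P : Measure (Config d)) (p : ℝ) : ℝ :=
  (P {U | U ∈ goodConfigs d ∧ zeroToInf κ U p}).toReal

/-- The critical point `p_c`. -/
noncomputable def pc {d : ℕ} (κ : ℕ) (P : Measure (Config d)) : ℝ :=
  sSup {p : ℝ | p ∈ Set.Icc (0 : ℝ) 1 ∧ thetaInf κ P p = 0}

/-- The modified one-arm probability `τ_n(p)`. -/
noncomputable def tau {d : ℕ} (κ : ℕ) (P : Measure (Config d)) (n : ℕ) (p : ℝ) : ℝ :=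
  (P {U | U ∈ goodConfigs d ∧ modifiedOneArm κ n p U}).toReal

/-- `e` is `p`-pivotal for `E_n(p)` at `U`. -/
def pPivotal {d : ℕ} (κ n : ℕ) (p : ℝ) (e : Sym2 (Vertex d)) (U : Config d) : Prop :=
  U ∈ goodConfigs d ∧ p < U e ∧ Function.update U e p ∈ goodConfigs d ∧
    ¬ (modifiedOneArm κ n p U ↔ modifiedOneArm κ n p (Function.update U e p))

/-- `e` is `U`-pivotal for `E_n(p)` at `U`. -/
def uPivotal {d : ℕ} (κ n : ℕ) (p : ℝ) (e : Sym2 (Vertex d)) (U : Config d) : Prop :=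
  U ∈ goodConfigs d ∧ ∃ U' ∈ goodConfigs d, (∀ f, f ≠ e → U' f = U f) ∧
    ¬ (modifiedOneArm κ n p U ↔ modifiedOneArm κ n p U')


/-- The edge set `𝓔_e` of the switching path of `e`: edges where `ω_p(U^{e+})` and
`ω_p(U^{e−})` differ. -/
def switchEdges {d : ℕ} (κ : ℕ) (U : Config d) (p : ℝ) (e : Sym2 (Vertex d)) :
    Set (Sym2 (Vertex d)) :=
  {f | IsNNEdge f ∧
    ¬ (openEdge κ (Function.update U e 0) p f ↔ openEdge κ (Function.update U e 1) p f)}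

/-- The vertex set `𝓥_e` of the switching path of `e`. -/
def switchVerts {d : ℕ} (κ : ℕ) (U : Config d) (p : ℝ) (e : Sym2 (Vertex d)) :
    Set (Vertex d) :=
  {v | ∃ f ∈ switchEdges κ U p e, v ∈ f}

/-- A *good* configuration (Case A): `U'_f > p` for every edge `f` meeting `𝓥_e` with
`ω⁺_f = 0`, and `U'_f = U_f` for every remaining edge `f ∈ 𝓔 \ 𝓔_e`. -/
def GoodCfg {d : ℕ} (κ : ℕ) (U Uplus : Config d) (p : ℝ) (e : Sym2 (Vertex d))
    (U' : Config d) : Prop :=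
  U' ∈ goodConfigs d ∧
    (∀ f, IsNNEdge f → (∃ v ∈ switchVerts κ U p e, v ∈ f) → ¬ openEdge κ Uplus p f →
      p < U' f) ∧
    (∀ f, IsNNEdge f → f ∉ switchEdges κ U p e →
      ¬ ((∃ v ∈ switchVerts κ U p e, v ∈ f) ∧ ¬ openEdge κ Uplus p f) → U' f = U f)

/-- The nearest-neighbour edges at `v` other than `f` that precede `f` and belong to `A`. -/
def earlier {d : ℕ} (U : Config d) (A : Sym2 (Vertex d) → Prop) (v : Vertex d)
    (f : Sym2 (Vertex d)) : Set (Sym2 (Vertex d)) :=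
  {g | IsNNEdge g ∧ v ∈ g ∧ g ≠ f ∧ U g < U f ∧ A g}

/-- `g` is a nearest-neighbour edge sharing a vertex with `f` and with smaller label. -/
def precedes {d : ℕ} (U : Config d) (g f : Sym2 (Vertex d)) : Prop :=
  IsNNEdge g ∧ (∃ v, v ∈ g ∧ v ∈ f) ∧ U g < U f

lemma adj_symm {d : ℕ} {x y : Vertex d} (h : adj x y) : adj y x := by
  unfold adj at *
  simpa only [abs_sub_comm] using h

lemma IsNNEdge.exists_eq_of_mem {d : ℕ} {g : Sym2 (Vertex d)} (hg : IsNNEdge g) {v : Vertex d}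
    (hv : v ∈ g) : ∃ w, adj v w ∧ g = s(v, w) := by
  obtain ⟨x, y, hxy, rfl⟩ := hg
  rcases Sym2.mem_iff.mp hv with rfl | rfl
  · exact ⟨y, hxy, rfl⟩
  · exact ⟨x, adj_symm hxy, Sym2.eq_swap⟩

lemma finite_edges_at {d : ℕ} (v : Vertex d) :
    {g : Sym2 (Vertex d) | IsNNEdge g ∧ v ∈ g}.Finite := by
  refine ((Set.finite_Icc (fun i => v i - 1) (fun i => v i + 1)).image
    (fun w : Vertex d => s(v, w))).subset ?_
  rintro g ⟨hg, hv⟩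
  obtain ⟨w, hw, rfl⟩ := hg.exists_eq_of_mem hv
  have hle : ∀ i, |v i - w i| ≤ 1 := fun i =>
    (Finset.single_le_sum (f := fun i => |v i - w i|) (fun j _ => abs_nonneg _)
      (Finset.mem_univ i)).trans_eq hw
  refine ⟨w, ⟨fun i => ?_, fun i => ?_⟩, rfl⟩
  · have := abs_le.mp (hle i)
    dsimp only
    linarith
  · have := abs_le.mp (hle i)
    dsimp only
    linarith

lemma wellFounded_precedes {d : ℕ} {U : Config d}
    (hU : ¬ ∃ w : ℕ → Vertex d, (∀ i, adj (w i) (w (i + 1))) ∧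
      StrictAnti (fun i => U s(w i, w (i + 1)))) :
    WellFounded (precedes U) := by
  let q : Vertex d × Vertex d → Vertex d × Vertex d → Prop := fun y x =>
    y.1 = x.2 ∧ adj y.1 y.2 ∧ U s(y.1, y.2) < U s(x.1, x.2)
  have hq : WellFounded q := by
    rw [wellFounded_iff_isEmpty_descending_chain]
    refine ⟨fun ⟨F, hF⟩ => hU ⟨fun i => (F i).2, fun i => ?_,
      strictAnti_nat_of_succ_lt fun i => ?_⟩⟩
    · obtain ⟨h1, h2, -⟩ := hF i
      rwa [h1] at h2
    · have h1 := (hF i).1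
      obtain ⟨h2, -, h3⟩ := hF (i + 1)
      dsimp only
      rwa [h1, h2] at h3
  have key : ∀ x : Vertex d × Vertex d, ∀ g, IsNNEdge g → x.2 ∈ g →
      U g < U s(x.1, x.2) → Acc (precedes U) g := by
    intro x
    induction x using hq.induction with
    | _ x ih =>
      have hfin : (U '' {g | IsNNEdge g ∧ x.2 ∈ g}).Finite := (finite_edges_at x.2).image U
      let P : ℝ → Prop := fun t => ∀ g, U g = t → IsNNEdge g → x.2 ∈ g →
        U g < U s(x.1, x.2) → Acc (precedes U) g
      suffices ∀ t ∈ U '' {g | IsNNEdge g ∧ x.2 ∈ g}, P t from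
        fun g hg hx hlt => this (U g) ⟨g, ⟨hg, hx⟩, rfl⟩ g rfl hg hx hlt
      intro t ht
      refine Set.WellFoundedOn.induction (P := P) hfin.isWF ht ?_
      rintro _ - ih' g rfl hg hx hlt
      obtain ⟨c, hc, rfl⟩ := hg.exists_eq_of_mem hx
      refine Acc.intro _ fun h ⟨hh, ⟨v, hvh, hv⟩, hlt'⟩ => ?_
      rcases Sym2.mem_iff.mp hv with rfl | rfl
      · exact ih' (U h) ⟨h, ⟨hh, hvh⟩, rfl⟩ hlt' h rfl hh hvh (hlt'.trans hlt)
      · exact ih (x.2, v) ⟨rfl, hc, hlt⟩ h hh hvh hlt'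
  have hNN : ∀ g, IsNNEdge g → Acc (precedes U) g := by
    rintro _ ⟨a, b, -, rfl⟩
    refine Acc.intro _ fun h ⟨hh, ⟨v, hvh, hv⟩, hlt⟩ => ?_
    rcases Sym2.mem_iff.mp hv with rfl | rfl
    · exact key (b, v) h hh hvh (by rwa [Sym2.eq_swap])
    · exact key (a, v) h hh hvh hlt
  exact ⟨fun f => Acc.intro _ fun g hg => hNN g hg.1⟩

/-- The constrained-degree recursion has at most one solution on nearest-neighbour edges. -/
lemma recursion_unique {d κ : ℕ} {U : Config d} (hwf : WellFounded (precedes U))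
    {Q A B : Sym2 (Vertex d) → Prop}
    (hA : ∀ f, IsNNEdge f → (A f ↔ Q f ∧ ∀ v ∈ f, (earlier U A v f).ncard < κ))
    (hB : ∀ f, IsNNEdge f → (B f ↔ Q f ∧ ∀ v ∈ f, (earlier U B v f).ncard < κ)) :
    ∀ f, IsNNEdge f → (A f ↔ B f) := by
  intro f
  induction f using hwf.induction with
  | _ f ih =>
    intro hf
    rw [hA f hf, hB f hf]
    have heq : ∀ v ∈ f, earlier U A v f = earlier U B v f := by
      intro v hv
      ext g
      constructor
      · rintro ⟨h1, h2, h3, h4, h5⟩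
        exact ⟨h1, h2, h3, h4, (ih g ⟨h1, ⟨v, h2, hv⟩, h4⟩ h1).mp h5⟩
      · rintro ⟨h1, h2, h3, h4, h5⟩
        exact ⟨h1, h2, h3, h4, (ih g ⟨h1, ⟨v, h2, hv⟩, h4⟩ h1).mpr h5⟩
    refine and_congr_right fun _ => forall₂_congr fun v hv => ?_
    rw [heq v hv]

lemma exists_consistent {d : ℕ} (κ : ℕ) {U : Config d} (hwf : WellFounded (precedes U)) :
    ∃ σ, Consistent κ U σ := by
  let F : ∀ f, (∀ g, precedes U g f → Prop) → Prop := fun f ih =>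
    ∀ v ∈ f, Set.ncard {g | v ∈ g ∧ ∃ h : precedes U g f, ih g h} < κ
  refine ⟨hwf.fix F, fun f _ => ?_⟩
  rw [hwf.fix_eq]
  refine forall₂_congr fun v hv => ?_
  have : {g | v ∈ g ∧ ∃ _ : precedes U g f, hwf.fix F g} =
      {g | IsNNEdge g ∧ v ∈ g ∧ g ≠ f ∧ U g < U f ∧ hwf.fix F g} := by
    ext g
    constructor
    · rintro ⟨h1, ⟨h2, -, h3⟩, h4⟩
      exact ⟨h2, h1, fun h => h3.ne (congrArg U h), h3, h4⟩
    · rintro ⟨h1, h2, -, h3, h4⟩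
      exact ⟨h2, ⟨h1, ⟨v, h2, hv⟩, h3⟩, h4⟩
  rw [this]

lemma openEdge_iff {d κ : ℕ} {U : Config d} (hwf : WellFounded (precedes U)) (p : ℝ)
    (f : Sym2 (Vertex d)) (hf : IsNNEdge f) :
    openEdge κ U p f ↔
      U f ≤ p ∧ ∀ v ∈ f, (earlier U (openEdge κ U p) v f).ncard < κ := by
  obtain ⟨σ, hσ⟩ := exists_consistent κ hwf
  have hopen : ∀ g, IsNNEdge g → (openEdge κ U p g ↔ U g ≤ p ∧ σ g) := by
    intro g hg
    refine ⟨fun ⟨_, h2, τ, hτ, h3⟩ => ⟨h2, ?_⟩, fun ⟨h1, h2⟩ => ⟨hg, h1, σ, hσ, h2⟩⟩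
    exact (recursion_unique hwf (Q := fun _ => True)
      (fun k hk => by rw [true_and]; exact hτ k hk)
      (fun k hk => by rw [true_and]; exact hσ k hk) g hg).mp h3
  rw [hopen f hf, hσ f hf]
  refine and_congr_right fun hp => forall₂_congr fun v _ => ?_
  have : {g | IsNNEdge g ∧ v ∈ g ∧ g ≠ f ∧ U g < U f ∧ σ g} =
      earlier U (openEdge κ U p) v f := by
    ext g
    constructor
    · rintro ⟨h1, h2, h3, h4, h5⟩
      exact ⟨h1, h2, h3, h4, (hopen g h1).mpr ⟨h4.le.trans hp, h5⟩⟩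
    · rintro ⟨h1, h2, h3, h4, h5⟩
      exact ⟨h1, h2, h3, h4, ((hopen g h1).mp h5).2⟩
  rw [this]

lemma wellFounded_precedes_of_mem {d : ℕ} {U : Config d} (hU : U ∈ goodConfigs d) :
    WellFounded (precedes U) :=
  wellFounded_precedes fun ⟨w, h1, h2⟩ => hU.2.2 ⟨w, h1, Or.inr h2⟩

/-- Every vertex of an open edge has fewer than `κ` other open edges. -/
lemma ncard_other_open_lt {d κ : ℕ} {U : Config d} (hU : U ∈ goodConfigs d) {p : ℝ}
    {f : Sym2 (Vertex d)} (hf : openEdge κ U p f) {v : Vertex d} (hv : v ∈ f) :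
    {g | IsNNEdge g ∧ v ∈ g ∧ g ≠ f ∧ openEdge κ U p g}.ncard < κ := by
  set T : Set (Sym2 (Vertex d)) := {g | IsNNEdge g ∧ v ∈ g ∧ openEdge κ U p g} with hT
  have hTfin : T.Finite := (finite_edges_at v).subset fun g hg => ⟨hg.1, hg.2.1⟩
  have hfT : f ∈ T := ⟨hf.1, hv, hf⟩
  obtain ⟨m, hm, hmax⟩ := Set.exists_max_image T U hTfin ⟨f, hfT⟩
  have hset : {g | IsNNEdge g ∧ v ∈ g ∧ g ≠ f ∧ openEdge κ U p g} = T \ {f} := by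
    ext g
    simp only [hT, Set.mem_ofPred_eq, Set.mem_sdiff, Set.mem_singleton_iff]
    tauto
  have hset' : T \ {m} = earlier U (openEdge κ U p) v m := by
    ext g
    constructor
    · rintro ⟨hg, hgm⟩
      exact ⟨hg.1, hg.2.1, hgm,
        lt_of_le_of_ne (hmax g hg) fun h => hgm (hU.2.1 g m hg.1 hm.1 h), hg.2.2⟩
    · rintro ⟨h1, h2, h3, -, h5⟩
      exact ⟨⟨h1, h2, h5⟩, h3⟩
  rw [hset, Set.ncard_sdiff_singleton_of_mem hfT, ← Set.ncard_sdiff_singleton_of_mem hm, hset']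
  exact ((openEdge_iff (wellFounded_precedes_of_mem hU) p m hm.1).mp hm.2.2).2 v hm.2.1

lemma wellFounded_precedes_update_zero {d : ℕ} {U : Config d} (hU : U ∈ goodConfigs d)
    (e : Sym2 (Vertex d)) : WellFounded (precedes (Function.update U e 0)) := by
  refine wellFounded_precedes fun ⟨w, hw, hanti⟩ => hU.2.2 ⟨w, hw, Or.inr ?_⟩
  have hnonneg : ∀ i, 0 ≤ Function.update U e 0 s(w i, w (i + 1)) := by
    intro i
    by_cases h : s(w i, w (i + 1)) = e
    · simp [h]
    · rw [Function.update_of_ne h]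
      exact (hU.1 _ ⟨_, _, hw i, rfl⟩).1
  have hne : ∀ i, s(w i, w (i + 1)) ≠ e := by
    intro i h
    have h1 : Function.update U e 0 s(w (i + 1), w (i + 1 + 1)) <
        Function.update U e 0 s(w i, w (i + 1)) := hanti (Nat.lt_succ_self i)
    have h2 := hnonneg (i + 1)
    rw [h, Function.update_self] at h1
    linarith
  convert hanti using 2 with i
  rw [Function.update_of_ne (hne i)]

lemma mem_switchEdges_self {d κ : ℕ} (hκ : 0 < κ) {p : ℝ} (hp : p ∈ Set.Ioo (0 : ℝ) 1)
    {U : Config d} (hU : U ∈ goodConfigs d) {e : Sym2 (Vertex d)} (he : IsNNEdge e) :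
    e ∈ switchEdges κ U p e := by
  refine ⟨he, fun h => ?_⟩
  have hopen : openEdge κ (Function.update U e 0) p e := by
    refine (openEdge_iff (wellFounded_precedes_update_zero hU e) p e he).mpr
      ⟨by simpa using hp.1.le, fun v _ => ?_⟩
    have : earlier (Function.update U e 0) (openEdge κ (Function.update U e 0) p) v e = ∅ := by
      refine Set.eq_empty_iff_forall_notMem.mpr ?_
      rintro g ⟨h1, -, h3, h4, -⟩
      rw [Function.update_self, Function.update_of_ne h3] at h4
      exact h4.not_ge (hU.1 g h1).1
    simpa [this] using hκ
  have := (h.mp hopen).2.1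
  rw [Function.update_self] at this
  exact hp.2.not_ge this

/-- **Claim 1 (Case A setup)**: every good configuration `U'` satisfies
`ω_p(U', f) = ω⁺_f` for `f ∉ 𝓔_e` and `ω_p(U', f) = 𝟙_{U'_f ≤ p}` for `f ∈ 𝓔_e`. -/
theorem good_config_unchanged (d κ n : ℕ) (hd : 2 ≤ d) (hκ₁ : 2 ≤ κ) (hκ₂ : κ ≤ 2 * d)
    (hn : 1 ≤ n) (p : ℝ) (hp : p ∈ Set.Ioo (0 : ℝ) 1)
    (U : Config d) (hU : U ∈ goodConfigs d)
    (hU01 : ∀ f, IsNNEdge f → U f ∈ Set.Ioo (0 : ℝ) 1)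
    (e : Sym2 (Vertex d)) (he : IsNNEdge e) (hpiv : uPivotal κ n p e U)
    (Uplus Uminus : Config d)
    (hUp : Uplus ∈ goodConfigs d) (hUpa : ∀ f, f ≠ e → Uplus f = U f)
    (hUpE : modifiedOneArm κ n p Uplus)
    (hUm : Uminus ∈ goodConfigs d) (hUma : ∀ f, f ≠ e → Uminus f = U f)
    (hUmE : ¬ modifiedOneArm κ n p Uminus)
    (U' : Config d) (hgood : GoodCfg κ U Uplus p e U') :
    (∀ f, IsNNEdge f → f ∉ switchEdges κ U p e →
      (openEdge κ U' p f ↔ openEdge κ Uplus p f)) ∧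
    (∀ f ∈ switchEdges κ U p e, (openEdge κ U' p f ↔ U' f ≤ p)) := by
  obtain ⟨hU'Ω, hclosed, hsame⟩ := hgood
  set S := switchEdges κ U p e with hS
  have heS : e ∈ S := mem_switchEdges_self (by omega) hp hU he
  have hUpS : ∀ f, f ∉ S → Uplus f = U f := fun f hf => hUpa f fun h => hf (h ▸ heS)
  let A : Sym2 (Vertex d) → Prop := fun f =>
    (f ∈ S ∧ U' f ≤ p) ∨ (f ∉ S ∧ openEdge κ Uplus p f)
  have hA_open : ∀ f, A f → openEdge κ Uplus p f := by
    rintro f (⟨h1, h2⟩ | ⟨-, h⟩)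
    · by_contra hcl
      obtain ⟨x, y, -, rfl⟩ := h1.1
      exact (hclosed _ h1.1 ⟨x, ⟨_, h1, Sym2.mem_mk_left x y⟩, Sym2.mem_mk_left x y⟩ hcl).not_ge h2
    · exact h
  have hlabel : ∀ f, f ∉ S → openEdge κ Uplus p f → U' f = Uplus f := fun f hf ho =>
    (hsame f ho.1 hf fun h => h.2 ho).trans (hUpS f hf).symm
  have hA_lt : ∀ f, A f → ∀ v ∈ f, (earlier U' A v f).ncard < κ := by
    intro f hf v hv
    refine lt_of_le_of_lt (Set.ncard_le_ncard ?_ ?_) (ncard_other_open_lt hUp (hA_open f hf) hv)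
    · rintro g ⟨h1, h2, h3, -, h5⟩
      exact ⟨h1, h2, h3, hA_open g h5⟩
    · exact (finite_edges_at v).subset fun g hg => ⟨hg.1, hg.2.1⟩
  have hA_le : ∀ f, A f → U' f ≤ p := by
    rintro f (⟨-, h⟩ | ⟨h1, h2⟩)
    · exact h
    · exact (hlabel f h1 h2).trans_le h2.2.1
  have hA_rec : ∀ f, IsNNEdge f →
      (A f ↔ U' f ≤ p ∧ ∀ v ∈ f, (earlier U' A v f).ncard < κ) := by
    intro f hf
    refine ⟨fun h => ⟨hA_le f h, hA_lt f h⟩, fun ⟨hle, hlt⟩ => ?_⟩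
    by_cases hfS : f ∈ S
    · exact Or.inl ⟨hfS, hle⟩
    refine Or.inr ⟨hfS, ?_⟩
    by_contra hcl
    have hV : ¬ ∃ v ∈ switchVerts κ U p e, v ∈ f := fun h => (hclosed f hf h hcl).not_ge hle
    have hUf : U' f = Uplus f :=
      (hsame f hf hfS fun h => hV h.1).trans (hUpS f hfS).symm
    refine hcl ((openEdge_iff (wellFounded_precedes_of_mem hUp) p f hf).mpr
      ⟨hUf ▸ hle, fun v hv => lt_of_le_of_lt (Set.ncard_le_ncard ?_ ?_) (hlt v hv)⟩)
    · rintro g ⟨h1, h2, h3, h4, h5⟩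
      have hgS : g ∉ S := fun h => hV ⟨v, ⟨g, h, h2⟩, hv⟩
      exact ⟨h1, h2, h3, by rwa [hlabel g hgS h5, hUf], Or.inr ⟨hgS, h5⟩⟩
    · exact (finite_edges_at v).subset fun g hg => ⟨hg.1, hg.2.1⟩
  have hA_eq : ∀ f, IsNNEdge f → (openEdge κ U' p f ↔ A f) :=
    have hwf := wellFounded_precedes_of_mem hU'Ω
    recursion_unique hwf (openEdge_iff hwf p) hA_rec
  refine ⟨fun f hf hfS => (hA_eq f hf).trans ?_, fun f hfS => (hA_eq f hfS.1).trans ?_⟩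
  · simp [A, hfS]
  · simp [A, hfS]

end CDP
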